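/- arXiv:2601.06934 — 2 statements merged into one kernel-verified Lean document; each statement's English description precedes it below -/
import Mathlib

section
/- Let G₁ be a group and H, K finite subgroups of G₁. If (ψ,g₁) and (ζ,r) are both swapping data for (H,K), then the subgroups Γ̃_{HK}·⟨ι_{ψ,g₁}⟩ and Γ̃_{HK}·⟨ι_{ζ,r}⟩ of Sym(Iso(H,K)) are equal. -/
universe u w

/-- The restriction to a subgroup `H` of an automorphism of `G` that leaves `H`
invariant. -/
def restrAut {G : Type u} [Group G] (H : Subgroup G) (α : G ≃* G)
    (hα : ∀ x : G, x ∈ H ↔ α x ∈ H) : H ≃* H where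
  toFun x := ⟨α x, (hα x).mp x.2⟩
  invFun x := ⟨α.symm x, (hα _).mpr (by simp)⟩
  left_inv x := by ext; simp
  right_inv x := by ext; simp
  map_mul' x y := by ext; simp

/-- The automorphism `x ↦ g·α(x)·g⁻¹` of a subgroup `K` invariant under it. -/
def conjAut {G : Type u} [Group G] (K : Subgroup G) (g : G) (α : G ≃* G)
    (hK : ∀ x : G, x ∈ K ↔ g * α x * g⁻¹ ∈ K) : K ≃* K where
  toFun x := ⟨g * α x * g⁻¹, (hK x).mp x.2⟩
  invFun x := ⟨α.symm (g⁻¹ * x * g), (hK _).mpr (by simp [mul_assoc])⟩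
  left_inv x := by ext; simp [mul_assoc]
  right_inv x := by ext; simp [mul_assoc]
  map_mul' x y := by ext; simp [mul_assoc]

/-- The permutation of `Iso(H,K)` induced by an element `(g,α)` of `Γ_{HK}`, i.e. a pair
with `α(H) = H` and `g·α(K)·g⁻¹ = K`.  It sends `f` to `h ↦ g·α(f(α⁻¹(h)))·g⁻¹`. -/
def gammaPerm {G : Type u} [Group G] (H K : Subgroup G) (g : G) (α : G ≃* G)
    (hα : ∀ x : G, x ∈ H ↔ α x ∈ H)
    (hK : ∀ x : G, x ∈ K ↔ g * α x * g⁻¹ ∈ K) : Equiv.Perm (H ≃* K) where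
  toFun f := ((restrAut H α hα).symm.trans f).trans (conjAut K g α hK)
  invFun f := ((restrAut H α hα).trans f).trans (conjAut K g α hK).symm
  left_inv f := by ext x; simp
  right_inv f := by ext x; simp

/-- `Γ̃_{HK}`: the image in `Sym(Iso(H,K))` of the stabilizer `Γ_{HK}`, i.e. the set of the
permutations `gammaPerm` induced by pairs `(g,α)` with `α(H) = H` and `g·α(K)·g⁻¹ = K`. -/
def gammaTildeSet {G : Type u} [Group G] (H K : Subgroup G) : Set (Equiv.Perm (H ≃* K)) :=
  {σ | ∃ (g : G) (α : G ≃* G) (hα : ∀ x : G, x ∈ H ↔ α x ∈ H)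
      (hK : ∀ x : G, x ∈ K ↔ g * α x * g⁻¹ ∈ K), σ = gammaPerm H K g α hα hK}

/-- The isomorphism `H ≃ K` obtained by restricting an automorphism `ψ` of `G` with
`ψ(H) = K`. -/
def restrMap {G : Type u} [Group G] (H K : Subgroup G) (ψ : G ≃* G)
    (h1 : ∀ x : G, x ∈ H ↔ ψ x ∈ K) : H ≃* K where
  toFun x := ⟨ψ x, (h1 x).mp x.2⟩
  invFun y := ⟨ψ.symm y, (h1 _).mpr (by simp)⟩
  left_inv x := by ext; simp
  right_inv y := by ext; simp
  map_mul' x y := by ext; simp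

/-- The isomorphism `H ≃ K`, `x ↦ ψ⁻¹(g₁⁻¹·x·g₁)`, coming from swapping data `(ψ,g₁)`
(where `ψ(K) = g₁⁻¹·H·g₁`, i.e. `∀ x, x ∈ K ↔ g₁·ψ(x)·g₁⁻¹ ∈ H`). -/
def dMap {G : Type u} [Group G] (H K : Subgroup G) (ψ : G ≃* G) (g₁ : G)
    (h2 : ∀ x : G, x ∈ K ↔ g₁ * ψ x * g₁⁻¹ ∈ H) : H ≃* K where
  toFun x := ⟨ψ.symm (g₁⁻¹ * x * g₁), (h2 _).mpr (by simp [mul_assoc])⟩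
  invFun y := ⟨g₁ * ψ y * g₁⁻¹, (h2 _).mp y.2⟩
  left_inv x := by ext; simp [mul_assoc]
  right_inv y := by ext; simp [mul_assoc]
  map_mul' x y := by ext; simp [mul_assoc]

/-- The permutation `ι_{ψ,g₁}` of `Iso(H,K)` attached to swapping data `(ψ,g₁)` for `(H,K)`
(i.e. `ψ(H) = K` and `ψ(K) = g₁⁻¹·H·g₁`): it sends `f` to
`h ↦ ψ⁻¹(g₁⁻¹·f⁻¹(ψ(h))·g₁)`. -/
def iotaPerm {G : Type u} [Group G] (H K : Subgroup G) (ψ : G ≃* G) (g₁ : G)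
    (h1 : ∀ x : G, x ∈ H ↔ ψ x ∈ K)
    (h2 : ∀ x : G, x ∈ K ↔ g₁ * ψ x * g₁⁻¹ ∈ H) : Equiv.Perm (H ≃* K) where
  toFun f := ((restrMap H K ψ h1).trans f.symm).trans (dMap H K ψ g₁ h2)
  invFun f := ((dMap H K ψ g₁ h2).trans f.symm).trans (restrMap H K ψ h1)
  left_inv f := by ext x; simp
  right_inv f := by ext x; simp

theorem coe_gammaPerm_apply {G : Type u} [Group G] (H K : Subgroup G) (g : G) (α : G ≃* G)
    (hα : ∀ x : G, x ∈ H ↔ α x ∈ H) (hK : ∀ x : G, x ∈ K ↔ g * α x * g⁻¹ ∈ K)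
    (f : H ≃* K) (h : H) :
    (gammaPerm H K g α hα hK f h : G) = g * α (f ((restrAut H α hα).symm h)) * g⁻¹ :=
  rfl

/-- A permutation of `Iso(H,K)` lies in `Γ̃_{HK}` as soon as it satisfies the defining formula
of some `(g,α)`, evaluated at the elements `α(h)`. -/
theorem mem_gammaTildeSet_of_apply {G : Type u} [Group G] {H K : Subgroup G}
    {σ : Equiv.Perm (H ≃* K)} (g : G) (α : G ≃* G)
    (hα : ∀ x : G, x ∈ H ↔ α x ∈ H) (hK : ∀ x : G, x ∈ K ↔ g * α x * g⁻¹ ∈ K)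
    (hσ : ∀ (f : H ≃* K) (h : H), (σ f (restrAut H α hα h) : G) = g * α (f h) * g⁻¹) :
    σ ∈ gammaTildeSet H K := by
  refine ⟨g, α, hα, hK, ?_⟩
  ext f h
  obtain ⟨h, rfl⟩ := (restrAut H α hα).surjective h
  rw [hσ, coe_gammaPerm_apply, MulEquiv.symm_apply_apply]

/-- `Γ̃_{HK}` as a subgroup of `Sym(Iso(H,K))`. -/
def gammaTilde {G : Type u} [Group G] (H K : Subgroup G) : Subgroup (Equiv.Perm (H ≃* K)) where
  carrier := gammaTildeSet H K
  one_mem' := mem_gammaTildeSet_of_apply 1 (MulEquiv.refl G) (by simp) (by simp)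
    fun f h ↦ by simp [restrAut]
  mul_mem' := by
    rintro _ _ ⟨g, α, hα, hK, rfl⟩ ⟨g', α', hα', hK', rfl⟩
    refine mem_gammaTildeSet_of_apply (g * α g') (α'.trans α)
      (fun x ↦ (hα' x).trans (hα _)) (fun x ↦ ?_) fun f h ↦ ?_
    · rw [hK' x, hK]
      simp [mul_assoc]
    · simp [gammaPerm, restrAut, conjAut, mul_assoc]
  inv_mem' := by
    rintro _ ⟨g, α, hα, hK, rfl⟩
    refine mem_gammaTildeSet_of_apply (α.symm g⁻¹) α.symm (fun x ↦ ?_) (fun x ↦ ?_) fun f h ↦ ?_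
    · rw [hα (α.symm x), α.apply_symm_apply]
    · rw [hK (_ * _ * _)]
      simp [mul_assoc]
    · rw [Equiv.Perm.inv_def]
      simp [gammaPerm, restrAut, conjAut, mul_assoc]

theorem iotaPerm_mem_normalizer {G : Type u} [Group G] (H K : Subgroup G) [Finite K]
    (ψ : G ≃* G) (g₁ : G) (h1 : ∀ x : G, x ∈ H ↔ ψ x ∈ K)
    (h2 : ∀ x : G, x ∈ K ↔ g₁ * ψ x * g₁⁻¹ ∈ H) :
    iotaPerm H K ψ g₁ h1 h2 ∈ Subgroup.normalizer (gammaTilde H K : Set (Equiv.Perm (H ≃* K))) := by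
  refine Subgroup.mem_normalizer_fintype ?_
  rintro _ ⟨g, α, hα, hK, rfl⟩
  refine mem_gammaTildeSet_of_apply (ψ.symm (g₁⁻¹ * α g₁ * g⁻¹))
    (((ψ.trans α).trans (MulAut.conj g)).trans ψ.symm) (fun x ↦ ?_) (fun x ↦ ?_) fun f h ↦ ?_
  · rw [h1 x, hK, h1 (MulEquiv.trans _ _ x)]
    simp
  · rw [h2 x, hα, h2 (_ * _ * _)]
    simp [mul_assoc]
  · obtain ⟨f, rfl⟩ := (iotaPerm H K ψ g₁ h1 h2).surjective f
    simp [iotaPerm, gammaPerm, restrAut, conjAut, restrMap, dMap, mul_assoc]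

theorem iotaPerm_mul_inv_mem_gammaTilde {G : Type u} [Group G] (H K : Subgroup G)
    (ψ ζ : G ≃* G) (g₁ r : G) (hψ1 : ∀ x : G, x ∈ H ↔ ψ x ∈ K)
    (hψ2 : ∀ x : G, x ∈ K ↔ g₁ * ψ x * g₁⁻¹ ∈ H) (hζ1 : ∀ x : G, x ∈ H ↔ ζ x ∈ K)
    (hζ2 : ∀ x : G, x ∈ K ↔ r * ζ x * r⁻¹ ∈ H) :
    iotaPerm H K ζ r hζ1 hζ2 * (iotaPerm H K ψ g₁ hψ1 hψ2)⁻¹ ∈ gammaTilde H K := by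
  refine mem_gammaTildeSet_of_apply (ζ.symm (r⁻¹ * g₁)) (ψ.trans ζ.symm)
    (fun x ↦ ?_) (fun x ↦ ?_) fun f h ↦ ?_
  · rw [hψ1 x, hζ1]
    simp
  · rw [hψ2 x, hζ2 (_ * _ * _)]
    simp [mul_assoc]
  · obtain ⟨f, rfl⟩ := (iotaPerm H K ψ g₁ hψ1 hψ2).surjective f
    simp [iotaPerm, restrAut, restrMap, dMap, mul_assoc]

theorem sup_zpowers_le_of_mul_inv_mem {P : Type*} [Group P] {N : Subgroup P} {a b : P}
    (h : a * b⁻¹ ∈ N) : N ⊔ Subgroup.zpowers a ≤ N ⊔ Subgroup.zpowers b := by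
  refine sup_le le_sup_left (Subgroup.zpowers_le.mpr ?_)
  simpa using Subgroup.mul_mem_sup h (Subgroup.mem_zpowers b)

theorem coe_gammaTilde_sup_zpowers_iotaPerm {G : Type u} [Group G] (H K : Subgroup G) [Finite K]
    (ψ : G ≃* G) (g₁ : G) (h1 : ∀ x : G, x ∈ H ↔ ψ x ∈ K)
    (h2 : ∀ x : G, x ∈ K ↔ g₁ * ψ x * g₁⁻¹ ∈ H) :
    {x | ∃ σ ∈ gammaTildeSet H K, ∃ n : ℤ, x = σ * iotaPerm H K ψ g₁ h1 h2 ^ n} =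
      (gammaTilde H K ⊔ Subgroup.zpowers (iotaPerm H K ψ g₁ h1 h2) :
        Subgroup (Equiv.Perm (H ≃* K))) := by
  rw [Subgroup.coe_mul_of_right_le_normalizer_left _ _
    (Subgroup.zpowers_le.mpr (iotaPerm_mem_normalizer H K ψ g₁ h1 h2))]
  ext x
  simp [Set.mem_mul, Subgroup.mem_zpowers_iff, gammaTilde, eq_comm]

/-- The subgroup `Γ̃_{HK}·⟨ι_{ψ,g₁}⟩` of `Sym(Iso(H,K))` does not depend on the choice of
swapping data `(ψ,g₁)` for `(H,K)`. -/
theorem gammaBar_independent_of_swapping_data {G₁ : Type u} [Group G₁] (H K : Subgroup G₁)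
    [Finite H] [Finite K] (ψ ζ : G₁ ≃* G₁) (g₁ r : G₁)
    (hψ1 : ∀ x : G₁, x ∈ H ↔ ψ x ∈ K)
    (hψ2 : ∀ x : G₁, x ∈ K ↔ g₁ * ψ x * g₁⁻¹ ∈ H)
    (hζ1 : ∀ x : G₁, x ∈ H ↔ ζ x ∈ K)
    (hζ2 : ∀ x : G₁, x ∈ K ↔ r * ζ x * r⁻¹ ∈ H) :
    {x | ∃ σ ∈ gammaTildeSet H K, ∃ n : ℤ, x = σ * iotaPerm H K ψ g₁ hψ1 hψ2 ^ n} =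
    {x | ∃ σ ∈ gammaTildeSet H K, ∃ n : ℤ, x = σ * iotaPerm H K ζ r hζ1 hζ2 ^ n} := by
  rw [coe_gammaTilde_sup_zpowers_iotaPerm, coe_gammaTilde_sup_zpowers_iotaPerm]
  exact congrArg _ (le_antisymm
    (sup_zpowers_le_of_mul_inv_mem (iotaPerm_mul_inv_mem_gammaTilde H K ζ ψ r g₁ hζ1 hζ2 hψ1 hψ2))
    (sup_zpowers_le_of_mul_inv_mem (iotaPerm_mul_inv_mem_gammaTilde H K ψ ζ g₁ r hψ1 hψ2 hζ1 hζ2)))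
end

section
/- Let G₁ be an OE-group and H, K finite subgroups of G₁ such that either K = H or H and K are not conjugate in G₁. Let f, f₁ : H → K be isomorphisms and set G = HNN(G₁,H,K,f) and B = HNN(G₁,H,K,f₁). Then G and B are isomorphic if and only if one of the following holds: (i) there exist an automorphism ψ of G₁ and g₁ ∈ G₁ with ψ(H) = K and ψ(K) = g₁⁻¹·H·g₁ such that ψ(f₁(ψ⁻¹(k))) = g₁⁻¹·f⁻¹(k)·g₁ for all k ∈ K; or (ii) there exist an automorphism ψ of G₁ and g₁ ∈ G₁ with ψ(H) = H and ψ(K) = g₁⁻¹·K·g₁ such that ψ(f₁(ψ⁻¹(h))) = g₁⁻¹·f(h)·g₁ for all h ∈ H. -/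
universe u w

/-- A group has the tree fixed-point property if every action of it without inversions
(given by a homomorphism to the permutations of the vertices preserving adjacency) on a
tree (a nonempty connected acyclic simple graph) in which all edge stabilizers are finite
fixes a vertex. -/
def TreeFixedPointProperty (Γ : Type*) [Group Γ] : Prop :=
  ∀ (V : Type w) (T : SimpleGraph V), T.IsTree →
    ∀ ρ : Γ →* Equiv.Perm V,
      (∀ (g : Γ) (x y : V), T.Adj x y → T.Adj (ρ g x) (ρ g y)) →
      (¬ ∃ (g : Γ) (x y : V), T.Adj x y ∧ ρ g x = y ∧ ρ g y = x) →
      (∀ x y : V, T.Adj x y → Set.Finite {g : Γ | ρ g x = x ∧ ρ g y = y}) →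
      ∃ v : V, ∀ g : Γ, ρ g v = v

/-- A group is residually finite if every nontrivial element is nontrivial in some finite
quotient. -/
def ResiduallyFinite (G : Type*) [Group G] : Prop :=
  ∀ g : G, g ≠ 1 → ∃ (Q : Type) (_ : Group Q), Finite Q ∧ ∃ φ : G →* Q, φ g ≠ 1

/-- An OE-group: a finitely generated, residually finite group with the tree fixed-point
property. -/
def IsOEGroup (Γ : Type*) [Group Γ] : Prop :=
  Group.FG Γ ∧ ResiduallyFinite Γ ∧ TreeFixedPointProperty.{w} Γ

namespace SimpleGraph

variable {V : Type*} {T : SimpleGraph V}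

/-- A geodesic from `x` to `u` avoids the edges from `u` to vertices further away from `x`. -/
theorem Connected.exists_walk_edge_notMem (hT : T.Connected) {x u v : V}
    (h : T.dist x u < T.dist x v) :
    ∃ p : T.Walk x u, s(u, v) ∉ p.edges := by
  classical
  obtain ⟨p, hp⟩ := hT.exists_walk_length_eq_dist x u
  refine ⟨p, fun hmem => ?_⟩
  have hv := p.snd_mem_support_of_mem_edges hmem
  have h1 := T.dist_le (p.takeUntil v hv)
  have h2 := p.length_takeUntil_le_length hv
  omega

/-- If an edge `u v` of a tree separates `x` from `y`, a geodesic from `x` to `y` crosses it. -/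
theorem IsTree.dist_eq_of_separates (hT : T.IsTree) {u v x y : V} (huv : T.Adj u v)
    (hx : T.dist x u < T.dist x v) (hy : T.dist y v < T.dist y u) :
    T.dist x y = T.dist x u + T.dist u y := by
  classical
  obtain ⟨p, hp⟩ := hT.connected.exists_walk_length_eq_dist x y
  obtain ⟨q, hq⟩ := hT.connected.exists_walk_edge_notMem hx
  obtain ⟨r, hr⟩ := hT.connected.exists_walk_edge_notMem hy
  have hbr := isBridge_iff_forall_walk_mem_edges.1
    (isAcyclic_iff_forall_adj_isBridge.1 hT.isAcyclic huv) ((q.reverse.append p).append r)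
  rw [Sym2.eq_swap] at hr
  have hmem : s(u, v) ∈ p.edges := by
    simpa [Walk.edges_append, hq, hr] using hbr
  have hu := p.fst_mem_support_of_mem_edges hmem
  have h1 := T.dist_le (p.takeUntil u hu)
  have h2 := T.dist_le (p.dropUntil u hu)
  have h3 := congrArg Walk.length (p.take_spec hu)
  rw [Walk.length_append] at h3
  have h4 := hT.connected.dist_triangle (u := x) (v := u) (w := y)
  omega

/-- The first step of a geodesic in a connected graph. -/
theorem Connected.exists_adj_dist_eq (hT : T.Connected) {x y : V} {n : ℕ}
    (h : T.dist x y = n + 1) : ∃ z, T.Adj x z ∧ T.dist z y = n := by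
  obtain ⟨p, hp⟩ := hT.exists_walk_length_eq_dist x y
  cases p with
  | nil => simp at h
  | @cons _ z _ hz q =>
    refine ⟨z, hz, ?_⟩
    have h1 := T.dist_le q
    have h2 := hT.dist_triangle (u := x) (v := z) (w := y)
    have h3 := dist_eq_one_iff_adj.2 hz
    simp only [Walk.length_cons] at hp
    omega

/-- The four-point condition for the metric of a tree. -/
theorem IsTree.dist_add_dist_le_max (hT : T.IsTree) (w x y z : V) :
    T.dist w x + T.dist y z ≤
      max (T.dist w y + T.dist x z) (T.dist w z + T.dist x y) := by
  induction hn : T.dist w x generalizing w with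
  | zero =>
    obtain rfl := hT.connected.dist_eq_zero_iff.1 hn
    have := hT.connected.dist_triangle (u := y) (v := w) (w := z)
    have := T.dist_comm (u := y) (v := w)
    omega
  | succ n ih =>
    obtain ⟨w', hadj, hw'⟩ := hT.connected.exists_adj_dist_eq hn
    have ih := ih w' hw'
    have key : ∀ v, T.dist w v < T.dist w' v → T.dist v x = T.dist v w + T.dist w x := by
      intro v hv
      refine hT.dist_eq_of_separates hadj ?_ ?_
      · rwa [T.dist_comm (u := v), T.dist_comm (u := v)]
      · rw [T.dist_comm (u := x), T.dist_comm (u := x)]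
        omega
    have hy := hT.dist_eq_dist_add_one_of_adj y hadj
    have hz := hT.dist_eq_dist_add_one_of_adj z hadj
    have c1 := T.dist_comm (u := y) (v := w)
    have c2 := T.dist_comm (u := y) (v := w')
    have c3 := T.dist_comm (u := z) (v := w)
    have c4 := T.dist_comm (u := z) (v := w')
    have c5 := T.dist_comm (u := x) (v := y)
    have c6 := T.dist_comm (u := x) (v := z)
    have t1 := hT.connected.dist_triangle (u := y) (v := w) (w := z)
    by_cases hy' : T.dist w y < T.dist w' y
    · have := key y hy'
      omega
    · by_cases hz' : T.dist w z < T.dist w' z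
      · have := key z hz'
        omega
      · omega

end SimpleGraph

theorem Subgroup.countable_of_closure_eq_top {G : Type*} [Group G] {S : Set G} (hS : S.Countable)
    (h : Subgroup.closure S = ⊤) : Countable G := by
  have := hS.to_subtype
  have : Countable (FreeGroup S) :=
    (Quot.mk_surjective : Function.Surjective (FreeGroup.mk (α := S))).countable
  have hsurj : Function.Surjective (FreeGroup.lift ((↑) : S → G)) := by
    rw [FreeGroup.lift_surjective_iff_closure_range_eq_top, Subtype.range_coe, h]
  exact hsurj.countable

theorem TreeFixedPointProperty.exists_fixed {Γ : Type*} [Group Γ]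
    (hΓ : TreeFixedPointProperty.{w} Γ) {V : Type*} [Small.{w} V] {T : SimpleGraph V}
    (hT : T.IsTree) (ρ : Γ →* Equiv.Perm V)
    (hadj : ∀ (g : Γ) (x y : V), T.Adj x y → T.Adj (ρ g x) (ρ g y))
    (hinv : ¬ ∃ (g : Γ) (x y : V), T.Adj x y ∧ ρ g x = y ∧ ρ g y = x)
    (hfin : ∀ x y : V, T.Adj x y → Set.Finite {g : Γ | ρ g x = x ∧ ρ g y = y}) :
    ∃ v : V, ∀ g : Γ, ρ g v = v := by
  let e := equivShrink.{w} V
  have hρ : ∀ (g : Γ) (x : Shrink.{w} V),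
      (e.permCongrHom.toMonoidHom.comp ρ) g x = e (ρ g (e.symm x)) := fun _ _ => rfl
  have hfix : ∃ v, ∀ g, (e.permCongrHom.toMonoidHom.comp ρ) g v = v := by
    refine hΓ _ (T.comap e.symm) ((SimpleGraph.Iso.comap e.symm T).isTree_iff.2 hT) _ ?_ ?_ ?_
    · intro g x y h
      simpa [hρ] using hadj g _ _ h
    · rintro ⟨g, x, y, h, h1, h2⟩
      exact hinv ⟨g, _, _, h, by rw [← h1, hρ, e.symm_apply_apply], by
        rw [← h2, hρ, e.symm_apply_apply]⟩
    · intro x y h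
      simpa [hρ, ← e.eq_symm_apply] using hfin _ _ h
  obtain ⟨v, hv⟩ := hfix
  exact ⟨e.symm v, fun g => e.injective (by rw [← hρ, hv, e.apply_symm_apply])⟩

/-- The tree of lists over `α`, in which a list is joined to its tail. -/
def List.tailGraph (α : Type*) : SimpleGraph (List α) where
  Adj l m := ∃ a, m = a :: l ∨ l = a :: m
  symm := ⟨fun _ _ ⟨a, h⟩ => ⟨a, h.symm⟩⟩
  loopless := ⟨fun _ ⟨_, h⟩ => by simp at h⟩

theorem List.tailGraph_isAcyclic (α : Type*) : (List.tailGraph α).IsAcyclic := by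
  have bridge : ∀ (a : α) (l : List α), (List.tailGraph α).IsBridge s(l, a :: l) := by
    intro a l
    rw [SimpleGraph.isBridge_iff]
    intro hr
    have key : ∀ m n, ((List.tailGraph α).deleteEdges {s(l, a :: l)}).Reachable m n →
        (a :: l <:+ n → a :: l <:+ m) := by
      rintro m n ⟨p⟩
      induction p with
      | nil => exact id
      | @cons m k n hadj _ ih =>
        intro hn
        have hk := ih hn
        rw [SimpleGraph.deleteEdges_adj] at hadj
        obtain ⟨⟨b, rfl | rfl⟩, hne⟩ := hadj
        · rcases List.suffix_cons_iff.1 hk with h | h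
          · obtain ⟨rfl, rfl⟩ := List.cons_eq_cons.1 h
            simp at hne
          · exact h
        · exact hk.trans (List.suffix_cons _ _)
    have := (key _ _ hr List.suffix_rfl).length_le
    simp at this
  refine SimpleGraph.isAcyclic_iff_forall_adj_isBridge.2 ?_
  rintro l m ⟨a, rfl | rfl⟩
  · exact bridge a l
  · rw [Sym2.eq_swap]
    exact bridge a m

namespace HNNExtension

open NormalWord Multiplicative

variable {G : Type*} [Group G] {A B : Subgroup G} (φ : A ≃* B)

/-- The exponent sum of the stable letter. -/
def exponentSum : HNNExtension G A B φ →* Multiplicative ℤ :=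
  lift 1 (ofAdd 1) (by simp)

@[simp]
theorem exponentSum_of (g : G) : exponentSum φ (of g) = 1 := by
  simp [exponentSum]

@[simp]
theorem exponentSum_t : exponentSum φ t = ofAdd 1 := by
  simp [exponentSum]

/-- The vertices of the Bass–Serre tree: left cosets of the base group. -/
abbrev Vertex : Type _ :=
  HNNExtension G A B φ ⧸ (of : G →* HNNExtension G A B φ).range

theorem vertex_mk_mul_of (x : HNNExtension G A B φ) (g : G) :
    ((x * of g : HNNExtension G A B φ) : Vertex φ) = x := by
  rw [QuotientGroup.eq]
  exact ⟨g⁻¹, by simp⟩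

theorem exponentSum_eq_of_vertex_eq {x y : HNNExtension G A B φ}
    (h : (x : Vertex φ) = y) : exponentSum φ x = exponentSum φ y := by
  obtain ⟨g, hg⟩ := QuotientGroup.eq.1 h
  have := congrArg (exponentSum φ) hg
  rw [exponentSum_of, map_mul, map_inv, eq_comm, inv_mul_eq_one] at this
  exact this

theorem exponentSum_t_zpow_ne_one (u : ℤˣ) : exponentSum φ (t ^ (u : ℤ)) ≠ 1 := by
  rcases Int.units_eq_one_or u with rfl | rfl <;> simp

/-- The Bass–Serre tree of an HNN extension. -/
def bassSerreTree : SimpleGraph (Vertex φ) where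
  Adj p q := ∃ (x : HNNExtension G A B φ) (u : ℤˣ), p = x ∧
    q = (x * t ^ (u : ℤ) : HNNExtension G A B φ)
  symm := ⟨by
    rintro _ _ ⟨x, u, rfl, rfl⟩
    exact ⟨x * t ^ (u : ℤ), -u, rfl, by simp⟩⟩
  loopless := ⟨by
    rintro _ ⟨x, u, rfl, h⟩
    have := exponentSum_eq_of_vertex_eq φ h
    rw [map_mul, left_eq_mul] at this
    exact exponentSum_t_zpow_ne_one φ u this⟩

theorem bassSerreTree_adj_mul (x : HNNExtension G A B φ) (u : ℤˣ) :
    (bassSerreTree φ).Adj x (x * t ^ (u : ℤ) : HNNExtension G A B φ) :=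
  ⟨x, u, rfl, rfl⟩

theorem bassSerreTree_adj_smul {p q : Vertex φ} (g : HNNExtension G A B φ)
    (h : (bassSerreTree φ).Adj p q) : (bassSerreTree φ).Adj (g • p) (g • q) := by
  obtain ⟨x, u, rfl, rfl⟩ := h
  exact ⟨g * x, u, rfl, by rw [mul_assoc]; rfl⟩

variable {φ} in
/-- An element of the HNN extension is a product of an element of the base group and of the
letters of a reduced word; this is the corresponding induction principle. -/
theorem induction_zpow_mul {motive : HNNExtension G A B φ → Prop} (x : HNNExtension G A B φ)
    (of : ∀ g, motive (of g))
    (mul : ∀ (g : G) (u : ℤˣ) x, motive x → motive (HNNExtension.of g * (t ^ (u : ℤ) * x))) :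
    motive x := by
  obtain ⟨d⟩ := TransversalPair.nonempty G A B
  obtain ⟨w, rfl⟩ := (NormalWord.equiv φ d).symm.surjective x
  change motive (w.prod φ)
  induction w using consRecOn with
  | ofGroup g => simpa [ReducedWord.prod] using of g
  | cons g u w h1 h2 ih =>
    rw [prod_cons]
    exact mul g u _ ih

theorem tailGraph_adj_unitsSMul {d : TransversalPair G A B} (u : ℤˣ) (w : NormalWord d) :
    (List.tailGraph _).Adj w.toList (unitsSMul φ u w).toList := by
  unfold unitsSMul
  by_cases h : Cancels u w
  · rw [dif_pos h]
    cases w using consRecOn with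
    | ofGroup => simp [Cancels] at h
    | cons g u' w h1 h2 => exact ⟨_, Or.inr rfl⟩
  · rw [dif_neg h]
    exact ⟨_, Or.inl rfl⟩

theorem bassSerreTree_isAcyclic : (bassSerreTree φ).IsAcyclic := by
  obtain ⟨d⟩ := TransversalPair.nonempty G A B
  let code (x : HNNExtension G A B φ) : List (ℤˣ × G) :=
    (x⁻¹ • (NormalWord.empty : NormalWord d)).toList
  have hcode : ∀ x y, code x = code y ↔ (x : Vertex φ) = y := by
    intro x y
    rw [QuotientGroup.eq]
    constructor
    · intro h
      refine ⟨(x⁻¹ • (NormalWord.empty : NormalWord d)).head *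
        (y⁻¹ • (NormalWord.empty : NormalWord d)).head⁻¹, ?_⟩
      rw [← mul_inv_eq_iff_eq_mul]
      refine (NormalWord.equiv φ d).injective ?_
      change (of _ * y⁻¹ : HNNExtension G A B φ) • (NormalWord.empty : NormalWord d) =
        x⁻¹ • (NormalWord.empty : NormalWord d)
      rw [mul_smul, of_smul_eq_smul]
      refine NormalWord.ext ?_ ?_
      · simp
      · simpa using h.symm
    · rintro ⟨g, hg⟩
      have : x⁻¹ = of g * y⁻¹ := by rw [hg]; group
      simp only [code, this, mul_smul, of_smul_eq_smul, group_smul_toList]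
  let f : Vertex φ → List (ℤˣ × G) :=
    Quotient.lift code fun x y h => (hcode x y).2 (Quotient.sound h)
  have hf : Function.Injective f := by
    rintro ⟨x⟩ ⟨y⟩ h
    exact (hcode x y).1 h
  refine (List.tailGraph_isAcyclic _).comap ⟨f, ?_⟩ hf
  rintro _ _ ⟨x, u, rfl, rfl⟩
  have : code (x * t ^ (u : ℤ)) =
      (unitsSMul φ (-u) (x⁻¹ • (NormalWord.empty : NormalWord d))).toList := by
    simp only [code]
    rw [← t_pow_smul_eq_unitsSMul, ← mul_smul]
    simp
  change (List.tailGraph _).Adj (code x) (code (x * t ^ (u : ℤ)))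
  rw [this]
  exact tailGraph_adj_unitsSMul φ _ _

theorem bassSerreTree_isTree : (bassSerreTree φ).IsTree := by
  refine ⟨?_, bassSerreTree_isAcyclic φ⟩
  have : Nonempty (Vertex φ) := ⟨((1 : HNNExtension G A B φ) : Vertex φ)⟩
  suffices h : ∀ x y : HNNExtension G A B φ,
      (bassSerreTree φ).Reachable (y : Vertex φ) (y * x : HNNExtension G A B φ) by
    refine ⟨?_⟩
    rintro ⟨x⟩ ⟨y⟩
    have hxy := h (x⁻¹ * y) x
    rwa [mul_inv_cancel_left] at hxy
  intro x
  induction x using induction_zpow_mul with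
  | of g =>
    intro y
    rw [vertex_mk_mul_of]
  | mul g u x ih =>
    intro y
    have h := (bassSerreTree_adj_mul φ (y * of g) u).reachable.trans (ih _)
    rw [vertex_mk_mul_of] at h
    simpa only [mul_assoc] using h

theorem bassSerreTree_dist_smul (g : HNNExtension G A B φ) (p q : Vertex φ) :
    (bassSerreTree φ).dist (g • p) (g • q) = (bassSerreTree φ).dist p q := by
  have le : ∀ (g : HNNExtension G A B φ) (p q : Vertex φ),
      (bassSerreTree φ).dist (g • p) (g • q) ≤ (bassSerreTree φ).dist p q := by
    intro g p q
    obtain ⟨w, hw⟩ := (bassSerreTree_isTree φ).connected.exists_walk_length_eq_dist p q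
    have := (bassSerreTree φ).dist_le
      (w.map (⟨(g • ·), bassSerreTree_adj_smul φ g⟩ : bassSerreTree φ →g bassSerreTree φ))
    rw [SimpleGraph.Walk.length_map, hw] at this
    exact this
  refine le_antisymm (le g p q) ?_
  simpa using le g⁻¹ (g • p) (g • q)

variable {φ}

/-- The number of occurrences of the stable letter in a reduced word, that is, the displacement
of the base vertex of the Bass–Serre tree. -/
noncomputable def len (x : HNNExtension G A B φ) : ℕ :=
  (bassSerreTree φ).dist ((1 : HNNExtension G A B φ) : Vertex φ) x

theorem dist_eq_len (x y : HNNExtension G A B φ) :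
    (bassSerreTree φ).dist (x : Vertex φ) y = len (x⁻¹ * y) := by
  rw [← bassSerreTree_dist_smul φ x⁻¹]
  change (bassSerreTree φ).dist ((x⁻¹ * x : HNNExtension G A B φ) : Vertex φ) _ = _
  rw [inv_mul_cancel]
  rfl

theorem len_eq_zero_iff {x : HNNExtension G A B φ} : len x = 0 ↔ ∃ g, of g = x := by
  rw [len, (bassSerreTree_isTree φ).connected.dist_eq_zero_iff, QuotientGroup.eq]
  simp

@[simp]
theorem len_of (g : G) : len (of g : HNNExtension G A B φ) = 0 :=
  len_eq_zero_iff.2 ⟨g, rfl⟩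

@[simp]
theorem len_one : len (1 : HNNExtension G A B φ) = 0 :=
  len_eq_zero_iff.2 ⟨1, map_one _⟩

@[simp]
theorem len_inv (x : HNNExtension G A B φ) : len x⁻¹ = len x := by
  have := dist_eq_len x 1
  rw [SimpleGraph.dist_comm, mul_one] at this
  exact this.symm

theorem len_four_point (x y z : HNNExtension G A B φ) :
    len x + len (y⁻¹ * z) ≤ max (len y + len (x⁻¹ * z)) (len z + len (x⁻¹ * y)) := by
  simp only [← dist_eq_len]
  exact (bassSerreTree_isTree φ).dist_add_dist_le_max _ _ _ _

theorem len_mul_le (x y : HNNExtension G A B φ) : len (x * y) ≤ len x + len y := by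
  have h := (bassSerreTree_isTree φ).connected.dist_triangle
    (u := ((x⁻¹ : HNNExtension G A B φ) : Vertex φ))
    (v := ((1 : HNNExtension G A B φ) : Vertex φ)) (w := (y : Vertex φ))
  simpa [dist_eq_len] using h

@[simp]
theorem len_mul_of (x : HNNExtension G A B φ) (g : G) : len (x * of g) = len x := by
  rw [len, vertex_mk_mul_of, len]

@[simp]
theorem len_of_mul (g : G) (x : HNNExtension G A B φ) : len (of g * x) = len x := by
  rw [← len_inv, mul_inv_rev, ← map_inv, len_mul_of, len_inv]

theorem len_mul_t_zpow_ne (x : HNNExtension G A B φ) (u : ℤˣ) :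
    len (x * t ^ (u : ℤ)) ≠ len x :=
  ((bassSerreTree_isTree φ).dist_ne_of_adj _ (bassSerreTree_adj_mul φ x u)).symm

@[simp]
theorem len_t_zpow (u : ℤˣ) : len (t ^ (u : ℤ) : HNNExtension G A B φ) = 1 := by
  rw [len, SimpleGraph.dist_eq_one_iff_adj]
  simpa using bassSerreTree_adj_mul φ 1 u

theorem exists_eq_mul_of_len_eq_succ {x : HNNExtension G A B φ} {n : ℕ} (h : len x = n + 1) :
    ∃ (g : G) (u : ℤˣ) (y : HNNExtension G A B φ), x = of g * t ^ (u : ℤ) * y ∧ len y = n := by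
  obtain ⟨q, ⟨y, u, h1, rfl⟩, hq⟩ :=
    (bassSerreTree_isTree φ).connected.exists_adj_dist_eq h
  obtain ⟨g, hg⟩ := QuotientGroup.eq.1 h1
  obtain rfl : of g = y := by simpa using hg
  refine ⟨g, u, (of g * t ^ (u : ℤ))⁻¹ * x, (mul_inv_cancel_left _ _).symm, ?_⟩
  rw [← hq, dist_eq_len]

/-- **Britton's Lemma** for conjugation by the stable letter. -/
theorem mem_toSubgroup_of_conj_mem {u : ℤˣ} {g g' : G}
    (h : (t ^ (u : ℤ) * of g : HNNExtension G A B φ) = of g' * t ^ (u : ℤ)) :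
    g ∈ toSubgroup A B u := by
  by_contra hg
  let w : ReducedWord G A B :=
    { head := g'⁻¹
      toList := [(u, g), (-u, 1)]
      chain := by simpa using fun h => absurd h hg }
  have := ReducedWord.toList_eq_nil_of_mem_of_range φ w ⟨1, by
    simp [ReducedWord.prod, w, h, mul_assoc]⟩
  simp [w] at this

/-- The paths from the base vertex to its images under `x` and `y` share their first edge. -/
def SharesFirstEdge (x y : HNNExtension G A B φ) : Prop :=
  len (x⁻¹ * y) < len x + len y

theorem SharesFirstEdge.symm {x y : HNNExtension G A B φ} (h : SharesFirstEdge x y) :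
    SharesFirstEdge y x := by
  unfold SharesFirstEdge at *
  rwa [← len_inv, mul_inv_rev, inv_inv, add_comm]

theorem SharesFirstEdge.trans {x y z : HNNExtension G A B φ} (h : SharesFirstEdge x y)
    (h' : SharesFirstEdge y z) : SharesFirstEdge x z := by
  unfold SharesFirstEdge at *
  have := len_four_point y x z
  have e : len (y⁻¹ * x) = len (x⁻¹ * y) := by rw [← len_inv, mul_inv_rev, inv_inv]
  omega

/-- If `q` moves the base vertex along the first edge of the path towards `x`, it also does so
for every `y` such that `x` and `y` share their first edge. -/
theorem SharesFirstEdge.len_eq {x y : HNNExtension G A B φ} (h : SharesFirstEdge x y)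
    {g : G} {u : ℤˣ} (hx : len x = len ((of g * t ^ (u : ℤ))⁻¹ * x) + 1) :
    len y = len ((of g * t ^ (u : ℤ))⁻¹ * y) + 1 := by
  unfold SharesFirstEdge at h
  set q : HNNExtension G A B φ := of g * t ^ (u : ℤ) with hq
  have hq1 : len q = 1 := by simp [hq]
  have h4 := len_four_point x q y
  have e : len (x⁻¹ * q) = len (q⁻¹ * x) := by rw [← len_inv, mul_inv_rev, inv_inv]
  have e' : len (y⁻¹ * q) = len (q⁻¹ * y) := by rw [← len_inv, mul_inv_rev, inv_inv]
  have hne : len (q⁻¹ * y) ≠ len y := by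
    rw [← e', hq, ← mul_assoc, ← len_inv y, ← len_mul_of y⁻¹ g]
    exact len_mul_t_zpow_ne _ u
  have t1 := len_mul_le q⁻¹ y
  have t2 := len_mul_le q (q⁻¹ * y)
  rw [mul_inv_cancel_left] at t2
  rw [len_inv] at t1
  omega

/-- Concatenations of reduced products along a nontrivial middle factor are reduced. -/
theorem len_mul_mul {x y z : HNNExtension G A B φ} (hxy : len (x * y) = len x + len y)
    (hyz : len (y * z) = len y + len z) (hy : len y ≠ 0) :
    len (x * (y * z)) = len x + len (y * z) := by
  have h4 := len_four_point (x * y) x (x * (y * z))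
  have e1 : (x * y)⁻¹ * (x * (y * z)) = z := by group
  have e2 : x⁻¹ * (x * (y * z)) = y * z := by group
  have e3 : len ((x * y)⁻¹ * x) = len y := by
    rw [← len_inv]; congr 1; group
  rw [e1, e2, e3] at h4
  have := len_mul_le x (y * z)
  omega

/-- The elements of the base group fixing the first edge of the path towards `x` lie in a
conjugate of an associated subgroup. -/
theorem exists_conj_mem_toSubgroup {x : HNNExtension G A B φ} (hx : len x ≠ 0) :
    ∃ (g : G) (u : ℤˣ), ∀ a : G, SharesFirstEdge x (of a * x) →
      g⁻¹ * a * g ∈ toSubgroup A B u := by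
  obtain ⟨n, hn⟩ := Nat.exists_eq_succ_of_ne_zero hx
  obtain ⟨g, u, y, rfl, hy⟩ := exists_eq_mul_of_len_eq_succ hn
  refine ⟨g, -u, fun a ha => ?_⟩
  set q : HNNExtension G A B φ := of g * t ^ (u : ℤ) with hq
  have hq1 : len q = 1 := by simp [hq]
  have h1 := ha.len_eq (g := g) (u := u) (by rw [← hq, inv_mul_cancel_left, hn, hy])
  rw [len_of_mul a, ← hq] at h1
  have h4 := len_four_point (of a * (q * y)) q (of a * q)
  have e1 : len ((of a * (q * y))⁻¹ * (of a * q)) = len y := by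
    rw [← len_inv]; congr 1; group
  have e2 : len ((of a * (q * y))⁻¹ * q) = len (q⁻¹ * (of a * (q * y))) := by
    rw [← len_inv]; congr 1; group
  rw [e1, e2, len_of_mul a q, len_of_mul a (q * y), hq1] at h4
  have h0 : len (q⁻¹ * (of a * q)) = 0 := by omega
  obtain ⟨b, hb⟩ := len_eq_zero_iff.1 h0
  refine mem_toSubgroup_of_conj_mem (φ := φ) (g' := b) ?_
  rw [hb, hq]
  simp [mul_assoc]

theorem sharesFirstEdge_inv_iff {x y : HNNExtension G A B φ} :
    SharesFirstEdge x⁻¹ y ↔ len (x * y) ≠ len x + len y := by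
  have := len_mul_le x y
  rw [SharesFirstEdge, inv_inv, len_inv]
  omega

@[simp]
theorem len_zpow_units (x : HNNExtension G A B φ) (u : ℤˣ) : len (x ^ (u : ℤ)) = len x := by
  obtain rfl | rfl := Int.units_eq_one_or u <;> simp

theorem card_toSubgroup (φ : A ≃* B) (u : ℤˣ) : Nat.card (toSubgroup A B u) = Nat.card A := by
  obtain rfl | rfl := Int.units_eq_one_or u
  · rfl
  · exact (Nat.card_congr φ.toEquiv).symm

/-- If a finite subgroup of the base group, of the same order as the associated subgroups, is
conjugated into the base group by `x⁻¹`, then it is the stabilizer of the first edge of the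
path towards `x`. -/
theorem mem_of_sharesFirstEdge [Finite A] {N : Subgroup G} (hN : Nat.card N = Nat.card A)
    {x : HNNExtension G A B φ} (hx : len x ≠ 0) (h : ∀ a ∈ N, ∃ g, x⁻¹ * of a = of g * x⁻¹)
    {a : G} (ha : SharesFirstEdge x (of a * x)) : a ∈ N := by
  obtain ⟨g, u, hgu⟩ := exists_conj_mem_toSubgroup hx
  have key : ∀ b, SharesFirstEdge x (of b * x) →
      b ∈ (toSubgroup A B u).map (MulAut.conj g).toMonoidHom := by
    intro b hb
    exact ⟨g⁻¹ * b * g, hgu b hb, by simp [mul_assoc]⟩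
  have hcard : Nat.card ((toSubgroup A B u).map (MulAut.conj g).toMonoidHom) = Nat.card A := by
    rw [← card_toSubgroup φ u]
    exact (Nat.card_congr ((toSubgroup A B u).equivMapOfInjective _
      (MulAut.conj g).injective).toEquiv).symm
  have : Finite ((toSubgroup A B u).map (MulAut.conj g).toMonoidHom) :=
    Nat.finite_of_card_ne_zero (by rw [hcard]; exact Nat.card_pos.ne')
  have hle : N ≤ (toSubgroup A B u).map (MulAut.conj g).toMonoidHom := by
    intro b hb
    refine key b ?_
    obtain ⟨c, hc⟩ := h b hb
    rw [SharesFirstEdge, ← mul_assoc, hc, inv_mul_cancel_right, len_of, len_of_mul]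
    omega
  rw [Subgroup.eq_of_le_of_card_ge hle (by rw [hcard, hN])]
  exact key a ha

/-- The elements `s ^ u₁ * b₁ * ⋯ * s ^ uₙ * bₙ`, with `b₁, …, bₙ` in the base group, such that
`uᵢ = uᵢ₊₁` whenever `bᵢ` lies in `S uᵢ`; the predicate records the first exponent. -/
inductive IsReducedProd (s : HNNExtension G A B φ) (S : ℤˣ → Subgroup G) :
    ℤˣ → HNNExtension G A B φ → Prop
  | single (u : ℤˣ) (b : G) : IsReducedProd s S u (s ^ (u : ℤ) * of b)
  | cons (u : ℤˣ) (b : G) {v : ℤˣ} {x : HNNExtension G A B φ} (hx : IsReducedProd s S v x)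
      (h : b ∈ S u → u = v) : IsReducedProd s S u (s ^ (u : ℤ) * (of b * x))

theorem exists_isReducedProd {s : HNNExtension G A B φ} {S : ℤˣ → Subgroup G}
    (hS : ∀ (u : ℤˣ), ∀ a ∈ S u, ∃ b ∈ S (-u), s ^ (u : ℤ) * of a = of b * s ^ (u : ℤ))
    (hs : Subgroup.closure (Set.range of ∪ {s}) = ⊤) (z : HNNExtension G A B φ) :
    (∃ g, z = of g) ∨ ∃ g u x, IsReducedProd s S u x ∧ z = of g * x := by
  have step : ∀ (u : ℤˣ) (z : HNNExtension G A B φ),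
      ((∃ g, z = of g) ∨ ∃ g u x, IsReducedProd s S u x ∧ z = of g * x) →
      ((∃ g, s ^ (u : ℤ) * z = of g) ∨
        ∃ g v x, IsReducedProd s S v x ∧ s ^ (u : ℤ) * z = of g * x) := by
    rintro u z (⟨g, rfl⟩ | ⟨g, v, x, hx, rfl⟩)
    · exact Or.inr ⟨1, u, _, .single u g, by simp⟩
    · by_cases h : g ∈ S u → u = v
      · exact Or.inr ⟨1, u, _, .cons u g hx h, by simp⟩
      · push Not at h
        obtain rfl : v = -u := by
          obtain rfl | rfl := Int.units_eq_one_or u <;>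
            obtain rfl | rfl := Int.units_eq_one_or v <;> simp_all
        obtain ⟨b, -, hb⟩ := hS u g h.1
        have hcancel : ∀ y, s ^ (u : ℤ) * (of g * (s ^ ((-u : ℤˣ) : ℤ) * y)) = of b * y := by
          intro y
          rw [← mul_assoc, hb]
          simp [mul_assoc]
        cases hx with
        | single _ c => exact Or.inl ⟨b * c, by rw [hcancel, map_mul]⟩
        | cons _ c hx h =>
          exact Or.inr ⟨b * c, _, _, hx, by rw [hcancel, map_mul, mul_assoc]⟩
  have hz : z ∈ Subgroup.closure (Set.range of ∪ {s}) := hs ▸ Subgroup.mem_top z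
  have hof : ∀ (a : G) (z : HNNExtension G A B φ),
      ((∃ g, z = of g) ∨ ∃ g u x, IsReducedProd s S u x ∧ z = of g * x) →
      ((∃ g, of a * z = of g) ∨ ∃ g v x, IsReducedProd s S v x ∧ of a * z = of g * x) := by
    rintro a z (⟨g, rfl⟩ | ⟨g, v, x, hx, rfl⟩)
    · exact Or.inl ⟨a * g, (map_mul _ _ _).symm⟩
    · exact Or.inr ⟨a * g, v, x, hx, by rw [map_mul, mul_assoc]⟩
  induction hz using Subgroup.closure_induction_left with
  | one => exact Or.inl ⟨1, (map_one _).symm⟩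
  | mul_left x hx y hy ih =>
    obtain ⟨a, rfl⟩ | rfl := hx
    · exact hof a y ih
    · simpa using step 1 y ih
  | inv_mul_cancel x hx y hy ih =>
    obtain ⟨a, rfl⟩ | rfl := hx
    · rw [← map_inv]
      exact hof a⁻¹ y ih
    · simpa using step (-1) y ih

theorem IsReducedProd.len_eq {s : HNNExtension G A B φ} {S : ℤˣ → Subgroup G}
    (hs : len s ≠ 0)
    (hS : ∀ (u v : ℤˣ) (b : G), (b ∈ S u → u = v) →
      len (s ^ (u : ℤ) * (of b * s ^ (v : ℤ))) = 2 * len s)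
    {u : ℤˣ} {x : HNNExtension G A B φ} (hx : IsReducedProd s S u x) :
    ∃ y, x = s ^ (u : ℤ) * y ∧ len x = len s + len y := by
  induction hx with
  | single u b => exact ⟨_, rfl, by simp⟩
  | cons u b hx h ih =>
    obtain ⟨y, rfl, hy⟩ := ih
    refine ⟨_, rfl, ?_⟩
    have := len_mul_mul (x := s ^ (u : ℤ)) (y := of b * s ^ (_ : ℤ)) (z := y)
      (by rw [hS _ _ _ h]; simp; omega) (by rw [mul_assoc]; simp [hy]) (by simpa using hs)
    simpa [mul_assoc] using this

theorem exists_cyclically_reduced {s : HNNExtension G A B φ} (hs : exponentSum φ s ≠ 1) :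
    ∃ c u, s = c * u * c⁻¹ ∧ len s = 2 * len c + len u ∧ len (u * u) = 2 * len u := by
  induction hn : len s using Nat.strong_induction_on generalizing s with
  | _ n ih =>
    subst hn
    by_cases h2 : len (s * s) = len s + len s
    · exact ⟨1, s, by simp, by simp, by omega⟩
    have hsh := (sharesFirstEdge_inv_iff.2 h2).symm
    have h0 : len s ≠ 0 := by
      intro h0
      have := len_mul_le s s
      omega
    obtain ⟨n, hn⟩ := Nat.exists_eq_succ_of_ne_zero h0
    obtain ⟨g, d, y, hsy, hy⟩ := exists_eq_mul_of_len_eq_succ hn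
    set q : HNNExtension G A B φ := of g * t ^ (d : ℤ) with hq
    have hq1 : len q = 1 := by rw [hq, len_of_mul, len_t_zpow]
    have hqs : q⁻¹ * s = y := by rw [hsy, inv_mul_cancel_left]
    have hinv := hsh.len_eq (g := g) (u := d) (by rw [← hq, hqs, hn, hy])
    rw [← hq, len_inv] at hinv
    have hsq : len (s * q) = n := by
      rw [← len_inv, mul_inv_rev]
      omega
    have hn0 : n ≠ 0 := by
      rintro rfl
      obtain ⟨a, ha⟩ := len_eq_zero_iff.1 hy
      obtain ⟨b, hb⟩ := len_eq_zero_iff.1 hsq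
      have e1 : exponentSum φ s = exponentSum φ q := by
        rw [hsy, ← ha]; simp
      have e2 : exponentSum φ s * exponentSum φ q = 1 := by
        rw [← map_mul, ← hb, exponentSum_of]
      rw [← e1] at e2
      refine hs ?_
      have e3 := congrArg Multiplicative.toAdd e2
      rw [toAdd_mul, toAdd_one] at e3
      exact Multiplicative.toAdd.injective (by rw [toAdd_one]; omega)
    have h4 := len_four_point s q (s * q)
    rw [inv_mul_cancel_left, hq1, hsq] at h4
    have e1 : len (s⁻¹ * q) = n := by rw [← len_inv, mul_inv_rev, inv_inv, hqs, hy]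
    rw [e1, hn] at h4
    obtain ⟨c, u, hc, hcu, hu⟩ := ih (len (q⁻¹ * (s * q))) (by omega) (s := q⁻¹ * (s * q))
      (by simpa [mul_comm (exponentSum φ s)] using hs) rfl
    have hsc : s = (q * c) * u * (q * c)⁻¹ := by
      rw [mul_inv_rev, ← mul_assoc, mul_assoc q, mul_assoc q, ← hc]
      group
    refine ⟨q * c, u, hsc, ?_, hu⟩
    have t1 := len_mul_le q c
    have t2 : len s ≤ len (q * c) + len u + len (q * c) := by
      conv_lhs => rw [hsc]
      refine (len_mul_le _ _).trans ?_
      rw [len_inv]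
      exact Nat.add_le_add_right (len_mul_le _ _) _
    omega

theorem IsReducedProd.exists_eq_of_normalized [Finite A] {s c u : HNNExtension G A B φ}
    {N : Subgroup G} (hN : Nat.card N = Nat.card A)
    (hsN : ∀ (d : ℤˣ), ∀ a ∈ N, ∃ b ∈ N, s ^ (d : ℤ) * of a = of b * s ^ (d : ℤ))
    (hsc : s = c * u * c⁻¹) (hlen : len s = 2 * len c + len u) (hu2 : len (u * u) = 2 * len u)
    (hc : len c ≠ 0) (hu : len u ≠ 0)
    {d : ℤˣ} {x : HNNExtension G A B φ} (hx : IsReducedProd s (fun _ => N) d x) :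
    ∃ a ∈ N, ∃ y, x = of a * (c * (u ^ (d : ℤ) * y)) ∧
      len (u ^ (d : ℤ) * y) = len u + len y := by
  have hpow : ∀ d : ℤˣ, s ^ (d : ℤ) = c * (u ^ (d : ℤ) * c⁻¹) := by
    intro d
    rw [hsc, conj_zpow, mul_assoc]
  have hlen' : ∀ d : ℤˣ, len (c * (u ^ (d : ℤ) * c⁻¹)) = 2 * len c + len u := by
    intro d
    rw [← hpow, len_zpow_units, hlen]
  have huc : ∀ d : ℤˣ, len (u ^ (d : ℤ) * c⁻¹) = len u + len c := by
    intro d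
    have t1 := len_mul_le c (u ^ (d : ℤ) * c⁻¹)
    have t2 := len_mul_le (u ^ (d : ℤ)) c⁻¹
    rw [hlen'] at t1
    rw [len_zpow_units, len_inv] at t2
    omega
  have huu : ∀ d : ℤˣ, len (u ^ (d : ℤ) * u ^ (d : ℤ)) = len u + len u := by
    intro d
    obtain rfl | rfl := Int.units_eq_one_or d
    · simp [hu2, two_mul]
    · rw [← len_inv]
      simp [hu2, two_mul]
  have hcu : ∀ d : ℤˣ, len (c * u ^ (d : ℤ)) = len c + len u := by
    intro d
    have t1 := len_mul_le (c * u ^ (d : ℤ)) c⁻¹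
    have t2 := len_mul_le c (u ^ (d : ℤ))
    rw [mul_assoc, hlen', len_inv] at t1
    rw [len_zpow_units] at t2
    omega
  have hcc : ∀ b ∉ N, len (c⁻¹ * (of b * c)) = len c + len c := by
    intro b hb
    have h1 : ¬ SharesFirstEdge s (of b * s) := fun h => hb <|
      mem_of_sharesFirstEdge hN (by omega)
        (fun a ha => (hsN (-1) a ha).imp fun g hg => by simpa using hg.2) h
    have h2 : s⁻¹ * (of b * s) = c * u⁻¹ * (c⁻¹ * (of b * c)) * (u * c⁻¹) := by
      rw [hsc]; group
    rw [SharesFirstEdge, h2, len_of_mul, not_lt] at h1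
    have t1 := len_mul_le (c * u⁻¹ * (c⁻¹ * (of b * c))) (u * c⁻¹)
    have t2 := len_mul_le (c * u⁻¹) (c⁻¹ * (of b * c))
    have t3 := len_mul_le c u⁻¹
    have t4 := len_mul_le u c⁻¹
    have t5 := len_mul_le c⁻¹ (of b * c)
    simp only [len_inv, len_of_mul] at t3 t4 t5
    omega
  induction hx with
  | single d b =>
    refine ⟨1, N.one_mem, c⁻¹ * of b, by simp [hpow, mul_assoc], ?_⟩
    rw [← mul_assoc, len_mul_of, len_mul_of, huc, len_inv]
  | @cons d b d' x hx h ih =>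
    obtain ⟨a, ha, y, rfl, hy⟩ := ih
    by_cases hb : b ∈ N
    · obtain rfl := h hb
      obtain ⟨a', ha', h'⟩ := hsN d (b * a) (N.mul_mem hb ha)
      refine ⟨a', ha', u ^ (d : ℤ) * y, ?_, ?_⟩
      · rw [← mul_assoc (of b), ← map_mul, ← mul_assoc, h', hpow]
        simp [mul_assoc]
      · rw [len_mul_mul (by simpa using huu d) (by simpa using hy) (by simpa using hu)]
        simp
    · have hba : b * a ∉ N := fun h => hb ((N.mul_mem_cancel_right ha).1 h)
      refine ⟨1, N.one_mem, c⁻¹ * (of (b * a) * c * (u ^ (d' : ℤ) * y)), ?_, ?_⟩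
      · simp [hpow, mul_assoc]
      have h1 : len (c * (u ^ (d' : ℤ) * y)) = len c + (len u + len y) := by
        rw [len_mul_mul (by simpa using hcu d') (by simpa using hy) (by simpa using hu), hy]
      have h2 : len (c⁻¹ * (of (b * a) * c * (u ^ (d' : ℤ) * y))) =
          len c⁻¹ + len (of (b * a) * c * (u ^ (d' : ℤ) * y)) := by
        refine len_mul_mul ?_ ?_ ?_
        · rw [hcc _ hba, len_inv, len_of_mul]
        · rw [mul_assoc, len_of_mul, len_of_mul, h1, hy]
        · rwa [len_of_mul]
      rw [len_mul_mul ?_ h2 (by simpa using hc)]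
      · simp
      · simpa using huc d

/-- Conjugation by `s` maps the base-group subgroups `H` and `K` onto each other. -/
structure IsConjPair (s : HNNExtension G A B φ) (H K : Subgroup G) : Prop where
  left : ∀ a ∈ H, ∃ b ∈ K, s * of a = of b * s
  right : ∀ b ∈ K, ∃ a ∈ H, s⁻¹ * of b = of a * s⁻¹

theorem len_mul_self_of_normalized [Finite A] {s : HNNExtension G A B φ} {N : Subgroup G}
    (hN : Nat.card N = Nat.card A) (hsN : IsConjPair s N N) (hexp : exponentSum φ s ≠ 1)
    (hs : Subgroup.closure (Set.range of ∪ {s}) = ⊤) :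
    len (s * s) = 2 * len s := by
  have hsN' : ∀ (d : ℤˣ), ∀ a ∈ N, ∃ b ∈ N, s ^ (d : ℤ) * of a = of b * s ^ (d : ℤ) := by
    intro d
    obtain rfl | rfl := Int.units_eq_one_or d
    · simpa using hsN.left
    · simpa using hsN.right
  obtain ⟨c, u, hsc, hlen, hu2⟩ := exists_cyclically_reduced hexp
  by_contra hss
  have hc : len c ≠ 0 := by
    intro h0
    obtain ⟨a, rfl⟩ := len_eq_zero_iff.1 h0
    refine hss ?_
    have : s * s = of a * (u * u) * of a⁻¹ := by
      rw [hsc, map_inv]; group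
    rw [this, len_mul_of, len_of_mul, hu2, hlen]
    simp
  have hu : len u ≠ 0 := by
    intro h0
    obtain ⟨a, rfl⟩ := len_eq_zero_iff.1 h0
    refine hexp ?_
    rw [hsc]
    simp
  obtain ⟨g, hg⟩ | ⟨g, d, x, hx, hg⟩ := exists_isReducedProd (S := fun _ => N) hsN' hs t
  · have := len_t_zpow (φ := φ) 1
    simp [hg] at this
  · obtain ⟨a, -, y, rfl, hy⟩ := hx.exists_eq_of_normalized hN hsN' hsc hlen hu2 hc hu
    have hcu : len (c * u ^ (d : ℤ)) = len c + len (u ^ (d : ℤ)) := by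
      have t1 := len_mul_le (c * u ^ (d : ℤ)) c⁻¹
      have t2 := len_mul_le c (u ^ (d : ℤ))
      rw [← conj_zpow, ← hsc, len_zpow_units, len_inv] at t1
      rw [len_zpow_units] at t2 ⊢
      omega
    have h1 := len_mul_mul hcu (by simpa using hy) (by simpa using hu)
    have h2 := len_t_zpow (φ := φ) 1
    simp only [Units.val_one, zpow_one] at h2
    rw [hg, len_of_mul, len_of_mul, h1, hy] at h2
    omega

theorem len_eq_one_of_closure_eq_top [Finite A] {s : HNNExtension G A B φ} {H K : Subgroup G}
    (hH : Nat.card H = Nat.card A) (hK : Nat.card K = Nat.card A) (hHK : IsConjPair s H K)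
    (hs : Subgroup.closure (Set.range of ∪ {s}) = ⊤) : len s = 1 := by
  have hexp : exponentSum φ s ≠ 1 := by
    intro h
    have hle : Subgroup.closure (Set.range of ∪ {s}) ≤ (exponentSum φ).ker := by
      rw [Subgroup.closure_le]
      rintro x (⟨g, rfl⟩ | rfl)
      · exact exponentSum_of φ g
      · exact h
    rw [hs] at hle
    have := hle (Subgroup.mem_top t)
    rw [MonoidHom.mem_ker] at this
    exact exponentSum_t_zpow_ne_one φ 1 (by simp at this)
  have h0 : len s ≠ 0 := by
    intro h0
    obtain ⟨a, rfl⟩ := len_eq_zero_iff.1 h0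
    exact hexp (exponentSum_of φ a)
  have hb : ∀ b, len (s * (of b * s)) = len s + len (of b * s) := by
    intro a
    by_contra h
    set s' := of a * s with hs'
    have hexp' : exponentSum φ s' ≠ 1 := by simpa [hs'] using hexp
    have hs'top : Subgroup.closure (Set.range of ∪ {s'}) = ⊤ := by
      rw [eq_top_iff, ← hs, Subgroup.closure_le]
      rintro x (⟨g, rfl⟩ | rfl)
      · exact Subgroup.subset_closure (Or.inl ⟨g, rfl⟩)
      · have h1 : (of a)⁻¹ ∈ Subgroup.closure (Set.range of ∪ {s'}) :=
          Subgroup.inv_mem _ (Subgroup.subset_closure (Or.inl ⟨a, rfl⟩))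
        have h2 : s' ∈ Subgroup.closure (Set.range of ∪ {s'}) :=
          Subgroup.subset_closure (Or.inr rfl)
        simpa [hs'] using Subgroup.mul_mem _ h1 h2
    set K' := K.map (MulAut.conj a).toMonoidHom with hK'
    have hK'card : Nat.card K' = Nat.card A := by
      rw [← hK]
      exact (Nat.card_congr (K.equivMapOfInjective _ (MulAut.conj a).injective).toEquiv).symm
    have hHK' : IsConjPair s' H K' := by
      constructor
      · intro x hx
        obtain ⟨b, hb, h⟩ := hHK.left x hx
        refine ⟨_, ⟨b, hb, rfl⟩, ?_⟩
        rw [hs', mul_assoc, h]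
        simp [mul_assoc]
      · rintro _ ⟨b, hb, rfl⟩
        obtain ⟨x, hx, h⟩ := hHK.right b hb
        refine ⟨x, hx, ?_⟩
        rw [hs', mul_inv_rev, ← mul_assoc, ← h]
        simp [mul_assoc]
    have hlen : len (s' * s') ≠ len s' + len s' := by
      have e : len (s' * s') = len (s * (of a * s)) := by rw [hs', mul_assoc, len_of_mul]
      rw [len_of_mul] at h
      rwa [e, hs', len_of_mul]
    have hsh : SharesFirstEdge s' s'⁻¹ := (sharesFirstEdge_inv_iff.2 hlen).symm
    have hfin : Finite K' :=
      Nat.finite_of_card_ne_zero (by rw [hK'card]; exact Nat.card_pos.ne')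
    have hs0 : len s' ≠ 0 := by simpa [hs'] using h0
    have hle : H ≤ K' := by
      intro x hx
      obtain ⟨b, -, hb⟩ := hHK'.left x hx
      refine mem_of_sharesFirstEdge hK'card hs0
        (fun y hy => (hHK'.right y hy).imp fun _ h => h.2) ?_
      have h1 : SharesFirstEdge s'⁻¹ (of x * s'⁻¹) := by
        rw [SharesFirstEdge, inv_inv, ← mul_assoc, hb]
        simp
        omega
      refine (hsh.trans h1).trans ?_
      have h2 := hsh.symm
      unfold SharesFirstEdge at h2 ⊢
      rw [len_of_mul, len_of_mul]
      convert h2 using 2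
      group
    have hEq := Subgroup.eq_of_le_of_card_ge hle (by rw [hK'card, hH])
    rw [← hEq] at hHK'
    have := len_mul_self_of_normalized hH hHK' hexp' hs'top
    omega
  have hS : ∀ (u : ℤˣ), ∀ a ∈ toSubgroup H K u, ∃ b ∈ toSubgroup H K (-u),
      s ^ (u : ℤ) * of a = of b * s ^ (u : ℤ) := by
    intro u
    obtain rfl | rfl := Int.units_eq_one_or u
    · simpa using hHK.left
    · simpa using hHK.right
  have hred : ∀ (u v : ℤˣ) (b : G), (b ∈ toSubgroup H K u → u = v) →
      len (s ^ (u : ℤ) * (of b * s ^ (v : ℤ))) = 2 * len s := by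
    intro u v b h
    rw [two_mul]
    by_cases huv : u = v
    · subst huv
      obtain rfl | rfl := Int.units_eq_one_or u
      · simpa using hb b
      · have h := hb b⁻¹
        rw [len_of_mul] at h
        rw [← len_inv]
        simpa [mul_assoc] using h
    · obtain rfl : v = -u := by
        obtain rfl | rfl := Int.units_eq_one_or u <;>
          obtain rfl | rfl := Int.units_eq_one_or v <;> simp_all
      by_contra hne
      refine huv (h ?_)
      have hcard : Nat.card (toSubgroup H K u) = Nat.card A := by
        obtain rfl | rfl := Int.units_eq_one_or u
        exacts [hH, hK]
      refine mem_of_sharesFirstEdge hcard (x := s ^ ((-u : ℤˣ) : ℤ)) (by simpa using h0) ?_ ?_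
      · intro a ha
        obtain ⟨c, -, hc⟩ := hS u a ha
        exact ⟨c, by simpa using hc⟩
      · have : SharesFirstEdge (s ^ (u : ℤ))⁻¹ (of b * s ^ ((-u : ℤˣ) : ℤ)) :=
          sharesFirstEdge_inv_iff.2 (by simpa using hne)
        simpa using this
  obtain ⟨g, hg⟩ | ⟨g, d, x, hx, hg⟩ := exists_isReducedProd hS hs t
  · have := len_t_zpow (φ := φ) 1
    simp [hg] at this
  · obtain ⟨y, -, hy⟩ := hx.len_eq h0 hred
    have h2 := len_t_zpow (φ := φ) 1
    simp only [Units.val_one, zpow_one] at h2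
    rw [hg, len_of_mul, hy] at h2
    omega

theorem closure_range_of_union_t (φ : A ≃* B) :
    Subgroup.closure (Set.range (of : G → HNNExtension G A B φ) ∪ {t}) = ⊤ := by
  rw [eq_top_iff]
  rintro x -
  have ht : t ∈ Subgroup.closure (Set.range (of : G → HNNExtension G A B φ) ∪ {t}) :=
    Subgroup.subset_closure (Or.inr rfl)
  induction x using induction_zpow_mul with
  | of g => exact Subgroup.subset_closure (Or.inl ⟨g, rfl⟩)
  | mul g u x ih =>
    exact Subgroup.mul_mem _ (Subgroup.subset_closure (Or.inl ⟨g, rfl⟩))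
      (Subgroup.mul_mem _ (zpow_mem ht _) ih)

instance instCountable [Countable G] : Countable (HNNExtension G A B φ) :=
  have hS : (Set.range (of : G → HNNExtension G A B φ) ∪ {t}).Countable :=
    (Set.countable_range _).union (Set.countable_singleton _)
  Subgroup.countable_of_closure_eq_top hS (closure_range_of_union_t φ)

/-- A finitely generated group with the tree fixed-point property that embeds in an HNN extension
with finite associated subgroups embeds in a conjugate of the base group. -/
theorem exists_eq_conj_of {Γ : Type*} [Group Γ] (hΓ : TreeFixedPointProperty.{w} Γ)
    [Countable G] [Finite A] {α : Γ →* HNNExtension G A B φ} (hα : Function.Injective α) :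
    ∃ (b : HNNExtension G A B φ) (θ : Γ →* G), ∀ x, α x = b * of (θ x) * b⁻¹ := by
  have : Countable (Vertex φ) := Quotient.countable
  have hfix : ∃ v : Vertex φ, ∀ x, α x • v = v := by
    refine hΓ.exists_fixed (bassSerreTree_isTree φ)
      ((MulAction.toPermHom (HNNExtension G A B φ) (Vertex φ)).comp α) ?_ ?_ ?_
    · exact fun x p q h => bassSerreTree_adj_smul φ _ h
    · rintro ⟨x, _, _, ⟨y, u, rfl, rfl⟩, h1, h2⟩
      have e1 := exponentSum_eq_of_vertex_eq φ (x := α x * y) h1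
      have e2 := exponentSum_eq_of_vertex_eq φ (x := α x * (y * t ^ (u : ℤ))) h2
      rw [map_mul, map_mul, mul_comm, mul_left_cancel_iff] at e1
      rw [map_mul, e1, map_mul, mul_left_comm, mul_eq_left] at e2
      refine exponentSum_t_zpow_ne_one φ u (Multiplicative.toAdd.injective ?_)
      have e3 := congrArg Multiplicative.toAdd e2
      rw [toAdd_mul, toAdd_one] at e3
      rw [toAdd_one]
      omega
    · rintro _ _ ⟨y, u, rfl, rfl⟩
      have : Finite (toSubgroup A B u) :=
        Nat.finite_of_card_ne_zero (by rw [card_toSubgroup φ u]; exact Nat.card_pos.ne')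
      refine ((Set.toFinite (toSubgroup A B u : Set G)).image fun a =>
        y * t ^ (u : ℤ) * of a * (y * t ^ (u : ℤ))⁻¹).preimage hα.injOn |>.subset ?_
      rintro x ⟨h1, h2⟩
      obtain ⟨g, hg⟩ := QuotientGroup.eq.1 h1.symm
      obtain ⟨a, ha⟩ := QuotientGroup.eq.1 h2.symm
      change _ = _ * (α x * _) at hg ha
      refine ⟨a, mem_toSubgroup_of_conj_mem (φ := φ) (g' := g) ?_, ?_⟩
      · rw [hg, ha]; group
      · change _ * of a * _ = α x
        rw [ha]; group
  obtain ⟨v, hv⟩ := hfix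
  obtain ⟨b, rfl⟩ := QuotientGroup.mk_surjective v
  have h : ∀ x, ∃ y, of y = b⁻¹ * α x * b := by
    intro x
    obtain ⟨y, hy⟩ := QuotientGroup.eq.1 (hv x).symm
    exact ⟨y, by rw [hy, mul_assoc]; rfl⟩
  choose θ hθ using h
  refine ⟨b, MonoidHom.mk' θ fun x y => of_injective φ ?_, fun x => ?_⟩
  · rw [map_mul, hθ, hθ, hθ, map_mul]
    group
  · rw [MonoidHom.mk'_apply, hθ]
    group

variable {A' B' : Subgroup G} {φ' : A' ≃* B'}

/-- If the base group has the tree fixed-point property, isomorphisms of HNN extensions with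
finite associated subgroups preserve it up to conjugation. -/
theorem exists_mulEquiv_of_eq (hG : TreeFixedPointProperty.{w} G) [Countable G] [Finite A]
    [Finite A'] (α : HNNExtension G A B φ ≃* HNNExtension G A' B' φ') :
    ∃ (β : HNNExtension G A B φ ≃* HNNExtension G A' B' φ') (ψ : G ≃* G),
      ∀ x, β (of x) = of (ψ x) := by
  obtain ⟨b, θ, hθ⟩ := exists_eq_conj_of hG (α := α.toMonoidHom.comp of)
    (α.injective.comp (of_injective φ))
  obtain ⟨c, θ', hθ'⟩ := exists_eq_conj_of hG (α := α.symm.toMonoidHom.comp of)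
    (α.symm.injective.comp (of_injective φ'))
  replace hθ : ∀ x, α (of x) = b * of (θ x) * b⁻¹ := hθ
  replace hθ' : ∀ x, α.symm (of x) = c * of (θ' x) * c⁻¹ := hθ'
  have hinj : Function.Injective θ := by
    intro x y h
    exact of_injective φ (α.injective (by rw [hθ, hθ, h]))
  have hinj' : Function.Injective θ' := by
    intro x y h
    exact of_injective φ' (α.symm.injective (by rw [hθ', hθ', h]))
  have hcomp : ∀ x, of (θ' (θ x)) = (α.symm b * c)⁻¹ * of x * (α.symm b * c) := by
    intro x
    have h := congrArg α.symm (hθ x)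
    rw [α.symm_apply_apply, map_mul, map_mul, hθ', map_inv] at h
    rw [h]
    group
  have hsurj : Function.Surjective θ := by
    by_cases he : len (α.symm b * c) = 0
    · obtain ⟨z, hz⟩ := len_eq_zero_iff.1 he
      intro y
      refine ⟨z * θ' y * z⁻¹, hinj' (of_injective φ ?_)⟩
      rw [hcomp, ← hz]
      simp only [map_mul, map_inv]
      group
    · obtain ⟨g, u, hgu⟩ := exists_conj_mem_toSubgroup he
      have hfin : Finite (toSubgroup A B u) :=
        Nat.finite_of_card_ne_zero (by rw [card_toSubgroup φ u]; exact Nat.card_pos.ne')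
      have hmem : ∀ a, g⁻¹ * a * g ∈ toSubgroup A B u := by
        intro a
        refine hgu a ?_
        rw [SharesFirstEdge, ← mul_assoc, ← hcomp, len_of]
        omega
      have : Finite G := Finite.of_injective
        (fun a => (⟨g⁻¹ * a * g, hmem a⟩ : toSubgroup A B u)) fun x y h => by
          simpa using congrArg Subtype.val h
      exact Finite.injective_iff_surjective.1 hinj
  refine ⟨α.trans (MulAut.conj b⁻¹), MulEquiv.ofBijective θ ⟨hinj, hsurj⟩, fun x => ?_⟩
  change b⁻¹ * α (of x) * b⁻¹⁻¹ = of (θ x)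
  rw [hθ]
  group

theorem exists_mulEquiv_t_zpow_mul_of (hG : TreeFixedPointProperty.{w} G) [Countable G] [Finite A]
    [Finite A'] (hcard : Nat.card A = Nat.card A')
    (α : HNNExtension G A B φ ≃* HNNExtension G A' B' φ') :
    ∃ (ψ : G ≃* G) (d : G) (u : ℤˣ), ∀ a : A,
      (t ^ (u : ℤ) * of (ψ a) : HNNExtension G A' B' φ') =
        of (d⁻¹ * ψ (φ a) * d) * t ^ (u : ℤ) := by
  obtain ⟨β, ψ, hβ⟩ := exists_mulEquiv_of_eq hG α
  have hcardmap : ∀ N : Subgroup G, Nat.card (N.map ψ.toMonoidHom) = Nat.card N := fun N =>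
    (Nat.card_congr (N.equivMapOfInjective _ ψ.injective).toEquiv).symm
  have ht : ∀ a : A, β t * of (ψ a) = of (ψ (φ a)) * β t := by
    intro a
    rw [← hβ, ← hβ, ← map_mul, ← map_mul, t_mul_of]
  have hlen : len (β t) = 1 := by
    refine len_eq_one_of_closure_eq_top (H := A.map ψ.toMonoidHom) (K := B.map ψ.toMonoidHom)
      ?_ ?_ ⟨?_, ?_⟩ ?_
    · rw [hcardmap, hcard]
    · rw [hcardmap, ← hcard]
      exact (Nat.card_congr φ.toEquiv).symm
    · rintro _ ⟨a, ha, rfl⟩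
      exact ⟨_, ⟨_, (φ ⟨a, ha⟩).2, rfl⟩, ht ⟨a, ha⟩⟩
    · rintro _ ⟨b, hb, rfl⟩
      refine ⟨_, ⟨_, (φ.symm ⟨b, hb⟩).2, rfl⟩, ?_⟩
      have := ht (φ.symm ⟨b, hb⟩)
      rw [φ.apply_symm_apply] at this
      rw [inv_mul_eq_iff_eq_mul, ← mul_assoc, eq_mul_inv_iff_mul_eq]
      exact this.symm
    · have h : (Subgroup.closure (Set.range of ∪ {β t})).comap β.toMonoidHom = ⊤ := by
        rw [eq_top_iff, ← closure_range_of_union_t φ, Subgroup.closure_le]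
        rintro x (⟨g, rfl⟩ | rfl)
        · exact Subgroup.subset_closure (Or.inl ⟨ψ g, (hβ g).symm⟩)
        · exact Subgroup.subset_closure (Or.inr rfl)
      rw [eq_top_iff]
      rintro x -
      obtain ⟨y, rfl⟩ := β.surjective x
      exact Subgroup.mem_comap.1 (h ▸ Subgroup.mem_top y)
  obtain ⟨p, u, y, hy, h0⟩ := exists_eq_mul_of_len_eq_succ hlen
  obtain ⟨c, rfl⟩ := len_eq_zero_iff.1 h0
  refine ⟨ψ.trans (MulAut.conj c), c * p, u, fun a => ?_⟩
  have h := ht a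
  rw [hy] at h
  have h' : (t ^ (u : ℤ) * (of c * of (ψ a)) : HNNExtension G A' B' φ') =
      (of p)⁻¹ * (of (ψ (φ a)) * (of p * t ^ (u : ℤ) * of c)) := by
    rw [← h]; group
  change _ * of (c * ψ a * c⁻¹) = of ((c * p)⁻¹ * (c * ψ (φ a) * c⁻¹) * (c * p)) * _
  rw [map_mul, map_mul, ← mul_assoc, h']
  simp [mul_assoc]

end HNNExtension

namespace HNNExtension

variable {G : Type*} [Group G] {H K : Subgroup G} {f f₁ : H ≃* K}

theorem nonempty_mulEquiv_of_swap (ψ : G ≃* G) (g₁ : G)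
    (hH : H.map ψ.toMonoidHom = K)
    (h : ∀ (k : K) (h : H), ψ h = k → ψ (f₁ h) = g₁⁻¹ * (f.symm k) * g₁) :
    Nonempty (HNNExtension G H K f ≃* HNNExtension G H K f₁) := by
  have mem : ∀ x ∈ H, ψ x ∈ K := fun x hx => hH ▸ ⟨x, hx, rfl⟩
  have mem_symm : ∀ k ∈ K, ψ.symm k ∈ H := by
    intro k hk
    rw [← hH] at hk
    obtain ⟨x, hx, rfl⟩ := hk
    simpa using hx
  let F : HNNExtension G H K f₁ →* HNNExtension G H K f :=
    lift (of.comp ψ.toMonoidHom) (of g₁⁻¹ * t⁻¹) <| by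
      intro a
      change of g₁⁻¹ * t⁻¹ * of (ψ a) = of (ψ (f₁ a)) * (of g₁⁻¹ * t⁻¹)
      rw [h ⟨ψ a, mem a a.2⟩ a rfl, mul_assoc, inv_t_mul_of ⟨ψ a, mem a a.2⟩]
      simp [mul_assoc]
  let F' : HNNExtension G H K f →* HNNExtension G H K f₁ :=
    lift (of.comp ψ.symm.toMonoidHom) (of (ψ.symm g₁) * t)⁻¹ <| by
      intro a
      change (of (ψ.symm g₁) * t)⁻¹ * of (ψ.symm a) =
        of (ψ.symm (f a)) * (of (ψ.symm g₁) * t)⁻¹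
      rw [inv_mul_eq_iff_eq_mul, ← mul_assoc, eq_mul_inv_iff_mul_eq, mul_assoc _ t,
        t_mul_of ⟨ψ.symm (f a), mem_symm _ (f a).2⟩, ← mul_assoc, ← mul_assoc, ← map_mul of,
        ← map_mul of]
      congr 2
      apply ψ.injective
      rw [map_mul, map_mul, h (f a) _ (ψ.apply_symm_apply _)]
      simp [mul_assoc]
  refine ⟨F'.toMulEquiv F ?_ ?_⟩
  · refine hom_ext ?_ ?_
    · ext x
      simp [F, F']
    · simp [F, F']
  · refine hom_ext ?_ ?_
    · ext x
      simp [F, F']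
    · simp [F, F']

theorem nonempty_mulEquiv_of_preserve (ψ : G ≃* G) (g₁ : G)
    (hH : H.map ψ.toMonoidHom = H)
    (h : ∀ h h' : H, ψ h' = h → ψ (f₁ h') = g₁⁻¹ * (f h) * g₁) :
    Nonempty (HNNExtension G H K f ≃* HNNExtension G H K f₁) := by
  have mem : ∀ x ∈ H, ψ x ∈ H := fun x hx => hH.le ⟨x, hx, rfl⟩
  have mem_symm : ∀ k ∈ H, ψ.symm k ∈ H := by
    intro k hk
    rw [← hH] at hk
    obtain ⟨x, hx, rfl⟩ := hk
    simpa using hx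
  let F : HNNExtension G H K f₁ →* HNNExtension G H K f :=
    lift (of.comp ψ.toMonoidHom) (of g₁⁻¹ * t) <| by
      intro a
      change of g₁⁻¹ * t * of (ψ a) = of (ψ (f₁ a)) * (of g₁⁻¹ * t)
      rw [h ⟨ψ a, mem a a.2⟩ a rfl, mul_assoc, t_mul_of ⟨ψ a, mem a a.2⟩]
      simp [mul_assoc]
  let F' : HNNExtension G H K f →* HNNExtension G H K f₁ :=
    lift (of.comp ψ.symm.toMonoidHom) (of (ψ.symm g₁) * t) <| by
      intro a
      change of (ψ.symm g₁) * t * of (ψ.symm a) =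
        of (ψ.symm (f a)) * (of (ψ.symm g₁) * t)
      rw [mul_assoc _ t, t_mul_of ⟨ψ.symm a, mem_symm _ a.2⟩, ← mul_assoc, ← mul_assoc,
        ← map_mul of, ← map_mul of]
      congr 2
      apply ψ.injective
      rw [map_mul, map_mul, h a _ (ψ.apply_symm_apply _)]
      simp [mul_assoc]
  refine ⟨F'.toMulEquiv F ?_ ?_⟩
  · refine hom_ext ?_ ?_
    · ext x
      simp [F, F']
    · simp [F, F']
  · refine hom_ext ?_ ?_
    · ext x
      simp [F, F']
    · simp [F, F']

theorem exists_preserve_of_t_mul_of [Finite H] (ψ : G ≃* G) (d : G)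
    (h : ∀ a : H, (t * of (ψ a) : HNNExtension G H K f₁) = of (d⁻¹ * ψ (f a) * d) * t) :
    ∃ (ψ : G ≃* G) (g₁ : G), H.map ψ.toMonoidHom = H ∧
      (∀ x : G, x ∈ K ↔ g₁ * ψ x * g₁⁻¹ ∈ K) ∧
      ∀ h h' : H, ψ h' = h → ψ (f₁ h') = g₁⁻¹ * (f h) * g₁ := by
  have mem : ∀ a ∈ H, ψ a ∈ H := by
    intro a ha
    have := mem_toSubgroup_of_conj_mem (φ := f₁) (u := 1)
      (g' := d⁻¹ * ψ (f ⟨a, ha⟩) * d) (by simpa using h ⟨a, ha⟩)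
    simpa using this
  have hmap : H.map ψ.toMonoidHom = H := by
    refine Subgroup.eq_of_le_of_card_ge ?_ ?_
    · rintro _ ⟨a, ha, rfl⟩
      exact mem a ha
    · exact (Nat.card_congr (H.equivMapOfInjective _ ψ.injective).toEquiv).le
  have mem_symm : ∀ k ∈ H, ψ.symm k ∈ H := by
    intro k hk
    rw [← hmap] at hk
    obtain ⟨x, hx, rfl⟩ := hk
    simpa using hx
  have key : ∀ a : H, (f₁ ⟨ψ a, mem a a.2⟩ : G) = d⁻¹ * ψ (f a) * d := by
    intro a
    have := h a
    rw [t_mul_of ⟨ψ a, mem a a.2⟩, mul_left_inj] at this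
    exact of_injective _ this
  refine ⟨ψ.symm, ψ.symm d, ?_, fun x => ⟨fun hx => ?_, fun hx => ?_⟩, ?_⟩
  · conv_lhs => rw [← hmap]
    ext x
    simp [Subgroup.mem_map]
  · obtain ⟨y, rfl⟩ : ∃ y : H, (f₁ y : G) = x := ⟨f₁.symm ⟨x, hx⟩, by simp⟩
    have := key ⟨_, mem_symm y y.2⟩
    simp only [MulEquiv.apply_symm_apply, Subtype.coe_eta] at this
    rw [this]
    simp [mul_assoc]
  · set k : K := ⟨_, hx⟩ with hk
    have := key (f.symm k)
    rw [f.apply_symm_apply, hk] at this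
    simp only [map_mul, MulEquiv.apply_symm_apply, map_inv] at this
    have e : x = d⁻¹ * (d * x * d⁻¹) * d := by group
    rw [e, ← this]
    exact SetLike.coe_mem _
  · intro y y' hy
    have := key y
    have e : (⟨ψ y, mem y y.2⟩ : H) = y' := Subtype.ext (by simp [← hy])
    rw [e] at this
    rw [this]
    simp

theorem exists_swap_of_inv_t_mul_of [Finite H] [Finite K] (ψ : G ≃* G) (d : G)
    (h : ∀ a : H, (t⁻¹ * of (ψ a) : HNNExtension G H K f₁) = of (d⁻¹ * ψ (f a) * d) * t⁻¹) :
    ∃ (ψ : G ≃* G) (g₁ : G), H.map ψ.toMonoidHom = K ∧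
      (∀ x : G, x ∈ K ↔ g₁ * ψ x * g₁⁻¹ ∈ H) ∧
      ∀ (k : K) (h : H), ψ h = k → ψ (f₁ h) = g₁⁻¹ * (f.symm k) * g₁ := by
  have mem : ∀ a ∈ H, ψ a ∈ K := by
    intro a ha
    have := mem_toSubgroup_of_conj_mem (φ := f₁) (u := -1)
      (g' := d⁻¹ * ψ (f ⟨a, ha⟩) * d) (by simpa using h ⟨a, ha⟩)
    simpa using this
  have hmap : H.map ψ.toMonoidHom = K := by
    refine Subgroup.eq_of_le_of_card_ge ?_ ?_
    · rintro _ ⟨a, ha, rfl⟩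
      exact mem a ha
    · rw [← Nat.card_congr f.toEquiv]
      exact (Nat.card_congr (H.equivMapOfInjective _ ψ.injective).toEquiv).le
  have mem_symm : ∀ k ∈ K, ψ.symm k ∈ H := by
    intro k hk
    rw [← hmap] at hk
    obtain ⟨x, hx, rfl⟩ := hk
    simpa using hx
  have key : ∀ a : H, (f₁.symm ⟨ψ a, mem a a.2⟩ : G) = d⁻¹ * ψ (f a) * d := by
    intro a
    have := h a
    rw [inv_t_mul_of ⟨ψ a, mem a a.2⟩, mul_left_inj] at this
    exact of_injective _ this
  have key' : ∀ y : H, ∃ a : H, (f₁ y : G) = ψ a ∧ (y : G) = d⁻¹ * ψ (f a) * d := by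
    intro y
    refine ⟨⟨_, mem_symm _ (f₁ y).2⟩, by simp, ?_⟩
    rw [← key]
    simp
  refine ⟨(MulAut.conj d).trans ψ.symm, (ψ.symm d)⁻¹, ?_, fun x => ?_, fun k y hy => ?_⟩
  · refine Subgroup.eq_of_le_of_card_ge ?_ ?_
    · rintro _ ⟨a, ha, rfl⟩
      obtain ⟨b, -, hb⟩ := key' ⟨a, ha⟩
      obtain rfl : a = _ := hb
      simp [mul_assoc]
    · rw [← Nat.card_congr f.toEquiv]
      exact (Nat.card_congr (H.equivMapOfInjective _ (MulEquiv.injective _)).toEquiv).le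
  · have e : (ψ.symm d)⁻¹ * ((MulAut.conj d).trans ψ.symm) x * (ψ.symm d)⁻¹⁻¹ = ψ.symm x := by
      simp [mul_assoc]
    rw [e]
    exact ⟨mem_symm x, fun hx => by simpa using mem _ hx⟩
  · obtain ⟨a, ha, hya⟩ := key' y
    have hk : f a = k := Subtype.ext <| by
      rw [← hy, hya]
      simp [mul_assoc]
    rw [ha, ← hk]
    simp

end HNNExtension

/-- Proposition: for an OE-group `G₁` and finite subgroups `H`, `K` with `K = H` or `H`, `K`
not conjugate in `G₁`, the HNN-extensions `HNN(G₁,H,K,f)` and `HNN(G₁,H,K,f₁)` are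
isomorphic iff (i) some automorphism `ψ` of `G₁` swaps the conjugacy classes of `H` and `K`
(`ψ(H) = K`, `ψ(K) = g₁⁻¹·H·g₁`) and `ψ ∘ f₁ ∘ ψ⁻¹ = τ_{g₁⁻¹} ∘ f⁻¹` on `K`, or
(ii) some automorphism `ψ` of `G₁` satisfies `ψ(H) = H`, `ψ(K) = g₁⁻¹·K·g₁` and
`ψ ∘ f₁ ∘ ψ⁻¹ = τ_{g₁⁻¹} ∘ f` on `H`. -/
theorem hnn_iso_iff_twist {G₁ : Type u} [Group G₁] (hOE : IsOEGroup.{w} G₁)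
    (H K : Subgroup G₁) [Finite H] [Finite K]
    (hHK : K = H ∨ ¬ ∃ g : G₁, ∀ x : G₁, x ∈ K ↔ g * x * g⁻¹ ∈ H)
    (f f₁ : H ≃* K) :
    Nonempty (HNNExtension G₁ H K f ≃* HNNExtension G₁ H K f₁) ↔
      ((∃ (ψ : G₁ ≃* G₁) (g₁ : G₁),
          H.map ψ.toMonoidHom = K ∧                        -- `ψ(H) = K`
          (∀ x : G₁, x ∈ K ↔ g₁ * ψ x * g₁⁻¹ ∈ H) ∧        -- `ψ(K) = g₁⁻¹·H·g₁`
          (∀ (k : K) (h : H), ψ (h : G₁) = (k : G₁) →      -- `h = ψ⁻¹(k)`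
            ψ (f₁ h : G₁) = g₁⁻¹ * (f.symm k : G₁) * g₁)) ∨
       (∃ (ψ : G₁ ≃* G₁) (g₁ : G₁),
          H.map ψ.toMonoidHom = H ∧                        -- `ψ(H) = H`
          (∀ x : G₁, x ∈ K ↔ g₁ * ψ x * g₁⁻¹ ∈ K) ∧        -- `ψ(K) = g₁⁻¹·K·g₁`
          (∀ (h h' : H), ψ (h' : G₁) = (h : G₁) →          -- `h' = ψ⁻¹(h)`
            ψ (f₁ h' : G₁) = g₁⁻¹ * (f h : G₁) * g₁))) := by
  obtain ⟨S, hS, hSfin⟩ := Group.fg_iff.1 hOE.1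
  have := Subgroup.countable_of_closure_eq_top hSfin.countable hS
  constructor
  · rintro ⟨α⟩
    obtain ⟨ψ, d, u, h⟩ := HNNExtension.exists_mulEquiv_t_zpow_mul_of hOE.2.2 rfl α
    obtain rfl | rfl := Int.units_eq_one_or u
    · exact Or.inr (HNNExtension.exists_preserve_of_t_mul_of ψ d (by simpa using h))
    · exact Or.inl (HNNExtension.exists_swap_of_inv_t_mul_of ψ d (by simpa using h))
  · rintro (⟨ψ, g₁, hH, -, h⟩ | ⟨ψ, g₁, hH, -, h⟩)
    · exact HNNExtension.nonempty_mulEquiv_of_swap ψ g₁ hH h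
    · exact HNNExtension.nonempty_mulEquiv_of_preserve ψ g₁ hH h
end
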